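/- arXiv:1803.04852 — 3 statements merged into one kernel-verified Lean document; each statement's English description precedes it below -/
import Mathlib

section
/- Let Λ be a lattice of rank d in ℝ^d and let C ⊆ ℝ^d be a compact convex set with nonempty interior that is symmetric about the origin. If |Λ ∩ int(C)| > 1 and vol(C) = (|Λ ∩ int(C)| + 1) · 2^{d−1} · det(Λ), then the linear span g of Λ ∩ int(C) is a line, C is a polytope, and C has an edge parallel to g. -/
open MeasureTheory ENNReal

noncomputable section

/-- Auxiliary recursion for the Sylvester sequence: `s_{i+1} = s_i (s_i - 1) + 1`,
which is equivalent to `s_i = 1 + s_1 ⋯ s_{i-1}` with `s_1 = 2`. -/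
def sylAux : ℕ → ℕ
  | 0 => 2
  | n + 1 => sylAux n * (sylAux n - 1) + 1

/-- The Sylvester sequence `s_1 = 2`, `s_i = 1 + s_1 s_2 ⋯ s_{i-1}` (1-indexed). -/
def syl (n : ℕ) : ℕ := sylAux (n - 1)

/-- The standard basis vector `e_i` of `ℝ^d`. -/
def stdBasis (d : ℕ) (i : Fin d) : Fin d → ℝ := Pi.single i 1

/-- The integer lattice `ℤ^d`, viewed as a subset of `ℝ^d`. -/
def latticePts (d : ℕ) : Set (Fin d → ℝ) :=
  Set.range fun z : Fin d → ℤ => fun i => (z i : ℝ)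

/-- The lattice `M ℤ^d` of rank `d` determined by a nonsingular matrix `M`;
its determinant is `|det M|`. -/
def matLattice {d : ℕ} (M : Matrix (Fin d) (Fin d) ℝ) : Set (Fin d → ℝ) :=
  Set.range fun z : Fin d → ℤ => M.mulVec fun i => (z i : ℝ)


lemma comb {G : Type*} [AddCommGroup G] [LinearOrder G] [IsOrderedAddMonoid G] (S : Finset G)
    (h0 : (0:G) ∈ S) (hsym : ∀ s ∈ S, -s ∈ S) :
    ∃ (m : ℕ) (v : G), S.card = 2 * m + 1 ∧
      (∀ A : Finset G, (∀ a ∈ A, ∀ b ∈ A, a - b ∈ S) → A.card ≤ m + 1) ∧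
      (∀ A : Finset G, (∀ a ∈ A, ∀ b ∈ A, a - b ∈ S) → A.card = m + 1 → 1 ≤ m →
        v ≠ 0 ∧ (∀ s, s ∈ S ↔ ∃ k : ℤ, |k| ≤ m ∧ s = k • v) ∧ ∃ a ∈ A, a + m • v ∈ A) := by
  classical
  set P := S.filter (fun s => 0 < s) with hP
  set N := S.filter (fun s => s < 0) with hN
  have hPm : ∀ s, s ∈ P ↔ s ∈ S ∧ 0 < s := by intro s; simp [hP]
  have hNP : N.card = P.card := by
    have : N = P.image (fun a => -a) := by
      ext a
      simp only [hN, hP, Finset.mem_image, Finset.mem_filter]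
      constructor
      · rintro ⟨h1, h2⟩
        exact ⟨-a, ⟨hsym _ h1, neg_pos.2 h2⟩, neg_neg a⟩
      · rintro ⟨b, ⟨h1, h2⟩, rfl⟩
        exact ⟨hsym _ h1, neg_lt_zero.2 h2⟩
    rw [this, Finset.card_image_of_injective _ neg_injective]
  have hS : S = insert 0 (P ∪ N) := by
    ext s
    simp only [Finset.mem_insert, Finset.mem_union, hP, hN, Finset.mem_filter]
    constructor
    · intro h
      rcases lt_trichotomy s 0 with h1 | h1 | h1 <;> tauto
    · rintro (rfl | h | h) <;> tauto
  have hdis : Disjoint P N := by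
    rw [Finset.disjoint_left]
    intro a ha hb
    simp only [hP, hN, Finset.mem_filter] at ha hb
    exact lt_asymm ha.2 hb.2
  have hcard : S.card = 2 * P.card + 1 := by
    rw [hS, Finset.card_insert_of_notMem (by simp [hP, hN]), Finset.card_union_of_disjoint hdis]
    omega
  have hmap : ∀ A : Finset G, (∀ a ∈ A, ∀ b ∈ A, a - b ∈ S) → ∀ a0 ∈ A, (∀ a ∈ A, a0 ≤ a) →
      ((A.erase a0).image (fun a => a - a0)) ⊆ P ∧
      ((A.erase a0).image (fun a => a - a0)).card + 1 = A.card := by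
    intro A hA a0 ha0 hmin
    constructor
    · intro s hs
      simp only [Finset.mem_image, Finset.mem_erase] at hs
      obtain ⟨a, ⟨hne, ha⟩, rfl⟩ := hs
      exact (hPm _).2 ⟨hA _ ha _ ha0, sub_pos.2 (lt_of_le_of_ne (hmin a ha) (Ne.symm hne))⟩
    · rw [Finset.card_image_of_injective _ (sub_left_injective), Finset.card_erase_add_one ha0]
  refine ⟨P.card, if h : P.Nonempty then P.min' h else 0, hcard, ?_, ?_⟩
  · intro A hA
    rcases A.eq_empty_or_nonempty with rfl | hne
    · simp
    have := hmap A hA (A.min' hne) (A.min'_mem hne) (fun a ha => A.min'_le a ha)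
    have h2 := Finset.card_le_card this.1
    omega
  · intro A hA hAc hm
    have hPne : P.Nonempty := Finset.card_pos.1 hm
    rw [dif_pos hPne]
    set v := P.min' hPne with hv
    have hvP : v ∈ P := P.min'_mem hPne
    have hv0 : 0 < v := ((hPm v).1 hvP).2
    have hne : A.Nonempty := Finset.card_pos.1 (by omega)
    set a0 := A.min' hne with ha0
    have ha0A : a0 ∈ A := A.min'_mem hne
    obtain ⟨h1, h2⟩ := hmap A hA a0 ha0A (fun a ha => A.min'_le a ha)
    have h3 := Finset.eq_of_subset_of_card_le h1 (by omega)
    have hPA : ∀ p ∈ P, a0 + p ∈ A := by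
      intro p hp
      rw [← h3] at hp
      simp only [Finset.mem_image, Finset.mem_erase] at hp
      obtain ⟨a, ⟨_, ha⟩, rfl⟩ := hp
      simpa using ha
    have hstep : ∀ p ∈ P, p ≠ v → p - v ∈ P := by
      intro p hp hpv
      refine (hPm _).2 ⟨?_, sub_pos.2 (lt_of_le_of_ne (P.min'_le p hp) (Ne.symm hpv))⟩
      have := hA _ (hPA p hp) _ (hPA v hvP)
      simpa using this
    -- the initial part
    have hinj : Function.Injective (fun k : ℕ => k • v) := by
      intro a b hab
      exact (nsmul_left_strictMono hv0).injective hab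
    have hmem : ∀ p ∈ P, ∃ k : ℕ, 1 ≤ k ∧ p = k • v := by
      by_contra hcon
      push Not at hcon
      set B := P.filter (fun p => ∀ k : ℕ, 1 ≤ k → p ≠ k • v) with hB
      have hBne : B.Nonempty := by
        obtain ⟨p, hp, hp2⟩ := hcon
        exact ⟨p, by simp only [hB, Finset.mem_filter]; exact ⟨hp, hp2⟩⟩
      have hq := B.min'_mem hBne
      set q := B.min' hBne with hqd
      have hq' := hq
      simp only [hB, Finset.mem_filter] at hq'
      have hqv : q ≠ v := by simpa using hq'.2 1 le_rfl
      have hqP := hstep q hq'.1 hqv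
      have : q - v ∈ B := by
        simp only [hB, Finset.mem_filter]
        refine ⟨hqP, fun k hk h => hq'.2 (k+1) (by omega) ?_⟩
        rw [succ_nsmul, ← h]; abel
      have := B.min'_le _ this
      rw [← hqd] at this
      have h5 : q - v < q := sub_lt_self _ hv0
      exact absurd this (not_le.2 h5)
    have hdown : ∀ k : ℕ, 1 ≤ k → (k+1) • v ∈ P → k • v ∈ P := by
      intro k hk h
      have := hstep _ h (by
        intro h'
        have : k + 1 = 1 := hinj (by simpa using h')
        omega)
      rwa [succ_nsmul, add_sub_cancel_right] at this
    have hdown' : ∀ k j : ℕ, 1 ≤ j → j ≤ k → k • v ∈ P → j • v ∈ P := by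
      intro k j hj hjk
      induction k, hjk using Nat.le_induction with
      | base => exact id
      | succ n hn ih => exact fun h => ih (hdown n (by omega) h)
    have hPeq : P = (Finset.Icc 1 P.card).image (fun k : ℕ => k • v) := by
      apply Finset.eq_of_subset_of_card_le
      · intro p hp
        obtain ⟨k, hk, rfl⟩ := hmem p hp
        simp only [Finset.mem_image, Finset.mem_Icc]
        refine ⟨k, ⟨hk, ?_⟩, rfl⟩
        have hsub : (Finset.Icc 1 k).image (fun k : ℕ => k • v) ⊆ P := by
          intro x hx
          simp only [Finset.mem_image, Finset.mem_Icc] at hx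
          obtain ⟨j, ⟨hj1, hj2⟩, rfl⟩ := hx
          exact hdown' k j hj1 hj2 hp
        have := Finset.card_le_card hsub
        rw [Finset.card_image_of_injective _ hinj] at this
        simpa using this
      · rw [Finset.card_image_of_injective _ hinj]; simp
    have hPk : ∀ k : ℕ, 1 ≤ k → k ≤ P.card → k • v ∈ P := by
      intro k h1 h2
      rw [hPeq]
      exact Finset.mem_image.2 ⟨k, Finset.mem_Icc.2 ⟨h1, h2⟩, rfl⟩
    have hPk' : ∀ p ∈ P, ∃ k : ℕ, k ≤ P.card ∧ p = k • v := by
      intro p hp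
      rw [hPeq] at hp
      obtain ⟨k, hk, rfl⟩ := Finset.mem_image.1 hp
      exact ⟨k, (Finset.mem_Icc.1 hk).2, rfl⟩
    refine ⟨hv0.ne', ?_, a0, ha0A, hPA _ (hPk _ hm le_rfl)⟩
    intro s
    constructor
    · intro hs
      rcases lt_trichotomy s 0 with h | h | h
      · obtain ⟨k, hk, hk2⟩ := hPk' (-s) ((hPm _).2 ⟨hsym _ hs, by simpa using h⟩)
        refine ⟨-k, by simpa using hk, ?_⟩
        rw [neg_smul, natCast_zsmul, ← hk2, neg_neg]
      · exact ⟨0, by simp, by simp [h]⟩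
      · obtain ⟨k, hk, hk2⟩ := hPk' s ((hPm _).2 ⟨hs, h⟩)
        refine ⟨k, by simpa using hk, ?_⟩
        rw [natCast_zsmul, ← hk2]
    · rintro ⟨k, hk, rfl⟩
      obtain ⟨n, rfl | rfl⟩ := Int.eq_nat_or_neg k
      · rcases Nat.eq_zero_or_pos n with rfl | hn
        · simpa using h0
        · rw [natCast_zsmul]
          exact ((hPm _).1 (hPk n hn (by simpa using hk))).1
      · rcases Nat.eq_zero_or_pos n with rfl | hn
        · simpa using h0
        · rw [neg_smul, natCast_zsmul]
          exact hsym _ ((hPm _).1 (hPk n hn (by simpa using hk))).1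

lemma comb' {d : ℕ} (S : Finset (Fin d → ℝ))
    (h0 : (0:Fin d → ℝ) ∈ S) (hsym : ∀ s ∈ S, -s ∈ S) :
    ∃ (m : ℕ) (v : Fin d → ℝ), S.card = 2 * m + 1 ∧
      (∀ A : Finset (Fin d → ℝ), (∀ a ∈ A, ∀ b ∈ A, a - b ∈ S) → A.card ≤ m + 1) ∧
      (∀ A : Finset (Fin d → ℝ), (∀ a ∈ A, ∀ b ∈ A, a - b ∈ S) → A.card = m + 1 → 1 ≤ m →
        v ≠ 0 ∧ (∀ s, s ∈ S ↔ ∃ k : ℤ, |k| ≤ m ∧ s = k • v) ∧ ∃ a ∈ A, a + m • v ∈ A) :=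
  @comb (Lex (Fin d → ℝ)) _ _ _ S h0 hsym


lemma polyhedron_polytope {d : ℕ} (C : Set (Fin d → ℝ)) (hCc : IsCompact C) (hCconv : Convex ℝ C)
    {ι : Type*} [Finite ι] (u : ι → (Fin d → ℝ) →L[ℝ] ℝ) (r : ι → ℝ)
    (hC : ∀ y, y ∈ C ↔ ∀ i, u i y ≤ r i) :
    ∃ V : Finset (Fin d → ℝ), C = convexHull ℝ (V : Set (Fin d → ℝ)) := by
  have hfin : (C.extremePoints ℝ).Finite := by
    refine Set.Finite.of_finite_image (f := fun x => {i | u i x = r i}) (Set.toFinite _) ?_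
    intro x hx y hy hxy
    by_contra hne
    have hx' := hx.1
    have hact : ∀ i, u i x = r i → u i y = r i := by
      intro i hi
      have : i ∈ {i | u i y = r i} := by
        have h2 : {i | u i x = r i} = {i | u i y = r i} := hxy
        rw [← h2]; exact hi
      exact this
    have key : ∀ᶠ ε : ℝ in nhdsWithin 0 (Set.Ioi 0), ∀ i, u i (x + ε • (x - y)) ≤ r i := by
      rw [Filter.eventually_all]
      intro i
      by_cases hi : u i x = r i
      · refine Filter.Eventually.of_forall fun ε => ?_
        simp [hi, hact i hi]
      · have hlt : u i x < r i := lt_of_le_of_ne ((hC x).1 hx' i) hi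
        have hcont : Continuous (fun ε : ℝ => u i (x + ε • (x - y))) := by fun_prop
        have := hcont.tendsto 0
        simp only [zero_smul, add_zero] at this
        filter_upwards [nhdsWithin_le_nhds (this.eventually (gt_mem_nhds hlt))] with ε hε
        exact hε.le
    obtain ⟨ε, h1, h2⟩ := (key.and self_mem_nhdsWithin).exists
    have h2 : 0 < ε := h2
    have hzC : x + ε • (x - y) ∈ C := (hC _).2 h1
    have : x ∈ openSegment ℝ y (x + ε • (x - y)) := by
      refine ⟨ε / (1 + ε), 1 / (1 + ε), by positivity, by positivity, by field_simp; ring, ?_⟩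
      ext j
      simp
      field_simp
      ring
    exact hne (hx.2 hy.1 hzC this).symm
  refine ⟨hfin.toFinset, ?_⟩
  rw [Set.Finite.coe_toFinset]
  conv_lhs => rw [← closure_convexHull_extremePoints hCc hCconv]
  exact (hfin.isClosed_convexHull (𝕜 := ℝ)).closure_eq

lemma geom {d : ℕ} (L : AddSubgroup (Fin d → ℝ)) [DiscreteTopology L]
    (C : Set (Fin d → ℝ)) (hCc : IsCompact C) (hCconv : Convex ℝ C)
    (h0 : 0 ∈ interior C) (hCsym : ∀ x ∈ C, -x ∈ C) (m : ℕ) (hm : 1 ≤ m)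
    (v : Fin d → ℝ) (hv0 : v ≠ 0)
    (hS : ∀ s, (s ∈ L ∧ s ∈ interior C) ↔ ∃ k : ℤ, |k| ≤ m ∧ s = k • v)
    (hstar : ∀ x, ∃ l ∈ L, x + (2:ℝ) • l ∈ C ∧ x + (2:ℝ) • l + (2 * m : ℝ) • v ∈ C) :
    (∃ V : Finset (Fin d → ℝ), C = convexHull ℝ (V : Set (Fin d → ℝ))) ∧
    (∃ E : Set (Fin d → ℝ), IsExtreme ℝ C E ∧ vectorSpan ℝ E = Submodule.span ℝ {v}) := by
  have hLclosed : IsClosed (L : Set (Fin d → ℝ)) := AddSubgroup.isClosed_of_discrete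
  have hcl : closure (interior C) = C := by
    rw [hCconv.closure_interior_eq_closure_of_nonempty_interior ⟨0, h0⟩, hCc.isClosed.closure_eq]
  have hvL : v ∈ L := ((hS v).2 ⟨1, by simpa using hm, by simp⟩).1
  have hhalf : ∀ x y, x ∈ interior C → y ∈ C → (1/2:ℝ) • x + (1/2:ℝ) • y ∈ interior C :=
    fun x y hx hy => hCconv.combo_interior_self_mem_interior hx hy (by norm_num) (by norm_num)
      (by norm_num)
  have hhalf' : ∀ x y, x ∈ C → y ∈ C → (1/2:ℝ) • x + (1/2:ℝ) • y ∈ C :=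
    fun x y hx hy => hCconv hx hy (by norm_num) (by norm_num) (by norm_num)
  have hKsym : ∀ x ∈ interior C, -x ∈ interior C := by
    intro x hx
    refine interior_maximal (s := C) (t := (fun y => -y) ⁻¹' interior C) (fun y hy => ?_)
      (isOpen_interior.preimage continuous_neg) (by simpa using hx)
    simpa using hCsym _ (interior_subset hy)
  -- supporting functionals
  have hsupp : ∀ x, x ∉ interior C → ∃ u : (Fin d → ℝ) →L[ℝ] ℝ, 0 < u x ∧ ∀ y ∈ C, u y ≤ u x := by
    intro x hx
    obtain ⟨f, hf⟩ := geometric_hahn_banach_open_point hCconv.interior isOpen_interior hx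
    refine ⟨f, by simpa using hf 0 h0, ?_⟩
    intro y hy
    rw [← hcl] at hy
    exact closure_minimal (fun a ha => (hf a ha).le)
      (isClosed_le f.continuous continuous_const) hy
  have hkint : ∀ k : ℤ, (m:ℤ) < |k| → k • v ∉ interior C := by
    intro k hk hmem
    obtain ⟨j, hj, hjk⟩ := (hS (k • v)).1 ⟨L.zsmul_mem hvL k, hmem⟩
    have : k = j := by
      have := sub_eq_zero.2 hjk
      rw [← sub_smul] at this
      rcases smul_eq_zero.1 this with h | h
      · omega
      · exact absurd h hv0
    subst this; omega
  constructor
  · -- polytope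
    choose! u hu0 hu using hsupp
    have hBfin : Finite {l : Fin d → ℝ // l ∈ L ∧ l ∈ C ∧ l ∉ interior C} := by
      have : (C ∩ (L : Set (Fin d → ℝ))).Finite :=
        Metric.finite_isBounded_inter_isClosed
          (SetLike.isDiscrete_iff_discreteTopology.2 inferInstance) hCc.isBounded hLclosed
      exact (this.subset (fun l hl => ⟨hl.2.1, hl.1⟩) :
        Set.Finite {l : Fin d → ℝ | l ∈ L ∧ l ∈ C ∧ l ∉ interior C})
    refine polyhedron_polytope C hCc hCconv
      (ι := {l : Fin d → ℝ // l ∈ L ∧ l ∈ C ∧ l ∉ interior C}) (fun l => u l.1) (fun l => u l.1 l.1) ?_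
    intro q
    refine ⟨fun hq l => hu _ l.2.2.2 q hq, fun hq => ?_⟩
    by_contra hqC
    -- every point outside C
    have hout : ∀ x, x ∉ C → ∃ l, (l ∈ L ∧ l ∉ interior C) ∧ x + (2:ℝ) • l ∈ C := by
      intro x hx
      obtain ⟨l, hl, h1, h2⟩ := hstar x
      by_cases hli : l ∈ interior C
      · obtain ⟨k, hk, rfl⟩ := (hS l).1 ⟨hl, hli⟩
        by_cases hkpos : 0 < k
        · refine ⟨(k + m) • v, ⟨L.zsmul_mem hvL _, hkint _ ?_⟩, ?_⟩
          · rw [abs_of_pos (by omega)]; omega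
          · convert h2 using 1
            rw [add_assoc, ← Int.cast_smul_eq_zsmul ℝ, ← Int.cast_smul_eq_zsmul ℝ, smul_smul,
              smul_smul, ← add_smul]
            push_cast
            congr 2; ring
        · exfalso
          apply hx
          have hk' : -(m:ℤ) ≤ k := (abs_le.1 hk).1
          have hk1 : -(m:ℝ) ≤ k := by exact_mod_cast hk'
          have hk2 : (k:ℝ) ≤ 0 := by exact_mod_cast (not_lt.1 hkpos)
          have hmR : (0:ℝ) < m := by exact_mod_cast hm
          have := hCconv h1 h2 (a := (k + m) / m) (b := -k / m)
            (by apply div_nonneg <;> linarith) (by apply div_nonneg <;> linarith)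
            (by field_simp; ring)
          convert this using 1
          ext j
          simp
          field_simp
          ring
      · exact ⟨l, ⟨hl, hli⟩, h1⟩
    have hclosed : IsClosed {x | ∃ l, (l ∈ L ∧ l ∉ interior C) ∧ x + (2:ℝ) • l ∈ C} := by
      have hX : IsClosed {l | l ∈ L ∧ l ∉ interior C} :=
        hLclosed.inter isOpen_interior.isClosed_compl
      have hX2 : IsClosed ((fun l => (-2:ℝ) • l) '' {l | l ∈ L ∧ l ∉ interior C}) :=
        (Homeomorph.smulOfNeZero (-2:ℝ) (by norm_num)).isClosedMap _ hX
      convert hX2.add_right_of_isCompact hCc using 1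
      ext x
      simp only [Set.mem_ofPred_eq, Set.mem_add, Set.mem_image]
      constructor
      · rintro ⟨l, hl, h⟩
        exact ⟨_, ⟨l, hl, rfl⟩, _, h, by module⟩
      · rintro ⟨_, ⟨l, hl, rfl⟩, c, hc, rfl⟩
        exact ⟨l, hl, by convert hc using 1; module⟩
    -- the last point
    have hT : IsCompact (Set.Icc (0:ℝ) 1 ∩ (fun s : ℝ => s • q) ⁻¹' C) :=
      isCompact_Icc.inter_right (hCc.isClosed.preimage (by fun_prop))
    obtain ⟨s, ⟨⟨hs0, hs1⟩, hsC⟩, hsmax⟩ := hT.exists_isMaxOn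
      ⟨0, by simpa using interior_subset h0⟩ continuousOn_id
    have hsC : s • q ∈ C := hsC
    have hs1' : s < 1 := by
      refine lt_of_le_of_ne hs1 ?_
      rintro rfl
      exact hqC (by simpa using hsC)
    have hsmem : s • q ∈ {x | ∃ l, (l ∈ L ∧ l ∉ interior C) ∧ x + (2:ℝ) • l ∈ C} := by
      have h1 : ∀ᶠ t in nhdsWithin s (Set.Ioi s),
          t • q ∈ {x | ∃ l, (l ∈ L ∧ l ∉ interior C) ∧ x + (2:ℝ) • l ∈ C} := by
        filter_upwards [Ioo_mem_nhdsGT hs1'] with t ht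
        apply hout
        intro htC
        have : t ≤ s := hsmax ⟨⟨by linarith [ht.1], ht.2.le⟩, htC⟩
        linarith [ht.1]
      have h2 : Filter.Tendsto (fun t : ℝ => t • q) (nhdsWithin s (Set.Ioi s)) (nhds (s • q)) := by
        have : Continuous (fun t : ℝ => t • q) := by fun_prop
        exact (this.tendsto s).mono_left nhdsWithin_le_nhds
      exact hclosed.mem_of_tendsto h2 h1
    obtain ⟨l, ⟨hlL, hli⟩, hl⟩ := hsmem
    have hnlC : -l ∈ C := by
      have := hhalf' _ _ hsC (hCsym _ hl)
      convert this using 1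
      module
    have hnli : -l ∉ interior C := fun h => hli (by simpa using hKsym _ h)
    have h1 := hq ⟨-l, L.neg_mem hlL, hnlC, hnli⟩
    have h2 := hu _ hnli _ (hCsym _ hl)
    have h3 := hu0 _ hnli
    simp only [map_neg, map_add, map_smul, smul_eq_mul] at h1 h2 h3
    have : s * u (-l) q ≤ s * (- u (-l) l) := mul_le_mul_of_nonneg_left h1 hs0
    nlinarith
  · -- edge
    have hmR : (1:ℝ) ≤ m := by exact_mod_cast hm
    obtain ⟨u0, hu00, hu0⟩ := hsupp (((m:ℤ)+1) • v) (hkint _ (by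
      rw [abs_of_pos (by omega)]; omega))
    have huv0 : 0 < u0 v := by
      rw [map_zsmul, zsmul_eq_mul] at hu00
      push_cast at hu00
      exact pos_of_mul_pos_right hu00 (by positivity)
    obtain ⟨u, huv, hu⟩ : ∃ u : (Fin d → ℝ) →L[ℝ] ℝ, u v = 1 ∧ ∀ y ∈ C, u y ≤ m + 1 := by
      refine ⟨(u0 v)⁻¹ • u0, by simp [huv0.ne'], ?_⟩
      intro y hy
      have := hu0 y hy
      rw [map_zsmul, zsmul_eq_mul] at this
      push_cast at this
      simp only [smul_apply, smul_eq_mul]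
      rw [inv_mul_le_iff₀ huv0]; linarith
    have hu' : ∀ y ∈ C, -(m + 1 : ℝ) ≤ u y := by
      intro y hy
      have := hu _ (hCsym y hy)
      rw [map_neg] at this
      linarith
    have hhK : ∀ x ∈ interior C, x + (m + 1 - u x) • v ∈ C := by
      intro x hx
      have hT : IsCompact (Set.Icc (-(m+1) - u x) (m + 1 - u x) ∩ (fun t : ℝ => x + t • v) ⁻¹' C) :=
        isCompact_Icc.inter_right (hCc.isClosed.preimage (by fun_prop))
      have hTiff : ∀ t : ℝ, x + t • v ∈ C →
          t ∈ Set.Icc (-(m+1) - u x) (m + 1 - u x) ∩ (fun t : ℝ => x + t • v) ⁻¹' C := by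
        intro t ht
        refine ⟨?_, ht⟩
        have h1 := hu _ ht
        have h2 := hu' _ ht
        simp only [map_add, map_smul, huv, smul_eq_mul, mul_one] at h1 h2
        constructor <;> linarith
      have hTne : (Set.Icc (-(m+1) - u x) (m + 1 - u x) ∩
          (fun t : ℝ => x + t • v) ⁻¹' C).Nonempty :=
        ⟨0, hTiff 0 (by simpa using interior_subset hx)⟩
      obtain ⟨b, hb, hbmax⟩ := hT.exists_isMaxOn hTne continuousOn_id
      obtain ⟨a, ha, hamin⟩ := hT.exists_isMinOn hTne continuousOn_id
      have hble : ∀ t : ℝ, x + t • v ∈ C → t ≤ b := fun t ht => hbmax (hTiff t ht)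
      have hale : ∀ t : ℝ, x + t • v ∈ C → a ≤ t := fun t ht => hamin (hTiff t ht)
      have haC : x + a • v ∈ C := ha.2
      have hbC : x + b • v ∈ C := hb.2
      -- strictly inside
      have hopen : ∀ᶠ t : ℝ in nhds 0, x + t • v ∈ C := by
        have hc : Continuous (fun t : ℝ => x + t • v) := by fun_prop
        have := hc.tendsto 0
        simp only [zero_smul, add_zero] at this
        filter_upwards [this.eventually (isOpen_interior.mem_nhds hx)] with t ht
        exact interior_subset ht
      have hb0 : 0 < b := by
        obtain ⟨t, ht, ht0⟩ := (hopen.filter_mono (nhdsWithin_le_nhds (s := Set.Ioi (0:ℝ))) |>.and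
          self_mem_nhdsWithin).exists
        exact lt_of_lt_of_le ht0 (hble t ht)
      have ha0 : a < 0 := by
        obtain ⟨t, ht, ht0⟩ := (hopen.filter_mono (nhdsWithin_le_nhds (s := Set.Iio (0:ℝ))) |>.and
          self_mem_nhdsWithin).exists
        exact lt_of_le_of_lt (hale t ht) ht0
      have hin : ∀ t, a < t → t < b → x + t • v ∈ interior C := by
        intro t hat htb
        rcases le_total 0 t with h | h
        · have := hCconv.combo_interior_self_mem_interior hx hbC (a := 1 - t / b) (b := t / b)
            (by rw [sub_pos, div_lt_one hb0]; exact htb) (by positivity) (by ring)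
          convert this using 1
          ext j; simp; field_simp; ring
        · have := hCconv.combo_interior_self_mem_interior hx haC (a := 1 - t / a) (b := t / a)
            (by rw [sub_pos, div_lt_one_of_neg ha0]; exact hat)
            (div_nonneg_of_nonpos h ha0.le) (by ring)
          convert this using 1
          have := ha0.ne
          ext j; simp; field_simp; ring
      have hkey : ∀ t, a < t → b - 2 < t → t < b → a ≤ t - 2 * m := by
        intro t hat hbt htb
        obtain ⟨l, hl, h1, h2⟩ := hstar (x + t • v)
        have hli : l ∈ interior C := by
          have := hhalf _ _ (hKsym _ (hin t hat htb)) h1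
          convert this using 1
          module
        obtain ⟨k, hk, rfl⟩ := (hS l).1 ⟨hl, hli⟩
        rw [← Int.cast_smul_eq_zsmul ℝ] at h1 h2
        have h1' := hale (t + 2 * k) (by convert h1 using 1; module)
        have h2' := hble (t + 2 * k + 2 * m) (by convert h2 using 1; module)
        have : ((k + m : ℤ) : ℝ) < 1 := by push_cast; linarith
        have : k + m < 1 := by exact_mod_cast this
        have : ((k + m : ℤ) : ℝ) ≤ 0 := by exact_mod_cast (by omega : k + m ≤ 0)
        push_cast at this
        linarith
      have hab : a ≤ b - 2 - 2 * m := by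
        by_cases h : b - 2 ≤ a
        · exfalso
          have hab : a < b := by linarith
          have h1 := hkey ((a + b) / 2) (by linarith) (by linarith) (by linarith)
          linarith
        · push Not at h
          by_contra hcon
          push Not at hcon
          have h1 := hkey (min (b - 1) ((b - 2 + (a + 2 * m))/2)) 
            (by rw [lt_min_iff]; constructor <;> linarith)
            (by rw [lt_min_iff]; constructor <;> linarith)
            (lt_of_le_of_lt (min_le_left _ _) (by linarith))
          have h2 := min_le_right (b - 1) ((b - 2 + (a + 2 * m))/2)
          linarith
      have h1 := hu _ hbC
      have h2 := hu' _ haC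
      simp only [map_add, map_smul, huv, smul_eq_mul, mul_one] at h1 h2
      have : m + 1 - u x = b := by linarith
      rw [this]; exact hbC
    have hh : ∀ x ∈ C, x + (m + 1 - u x) • v ∈ C := by
      intro x hx
      rw [← hcl] at hx
      exact closure_minimal (t := {x | x + (m + 1 - u x) • v ∈ C}) hhK
        (hCc.isClosed.preimage (by fun_prop)) hx
    have hh' : ∀ x ∈ C, x - (m + 1 + u x) • v ∈ C := by
      intro x hx
      have := hCsym _ (hh _ (hCsym x hx))
      convert this using 1
      rw [map_neg]
      module
    -- face
    have hFc : IsCompact (C ∩ {x | u x = m + 1}) :=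
      hCc.inter_right (isClosed_eq u.continuous continuous_const)
    have hFne : (C ∩ {x | u x = m + 1}).Nonempty :=
      ⟨_, hh 0 (interior_subset h0), by simp [huv]⟩
    obtain ⟨e, he⟩ := hFc.extremePoints_nonempty hFne
    have heC : e ∈ C := he.1.1
    have heu : u e = m + 1 := he.1.2
    have he' : e - (2 * (m + 1) : ℝ) • v ∈ C := by
      have := hh' e heC
      rw [heu] at this
      convert this using 2
      ring_nf
    have hseg : ∀ x, x ∈ segment ℝ (e - (2 * (m + 1) : ℝ) • v) e ↔ 
        ∃ t : ℝ, 0 ≤ t ∧ t ≤ 2 * (m + 1) ∧ x = e - t • v := by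
      intro x
      constructor
      · rintro ⟨a, b, ha, hb, hab, rfl⟩
        refine ⟨a * (2 * (m + 1)), by positivity, ?_, ?_⟩
        · have : a ≤ 1 := by linarith
          nlinarith
        · have : b = 1 - a := by linarith
          subst this
          module
      · rintro ⟨t, ht0, ht1, rfl⟩
        refine ⟨t / (2 * (m + 1)), 1 - t / (2 * (m + 1)), by positivity, ?_, by ring, ?_⟩
        · rw [sub_nonneg, div_le_one (by positivity)]; exact ht1
        · ext j; simp; field_simp; ring
    refine ⟨segment ℝ (e - (2 * (m + 1) : ℝ) • v) e, ⟨hCconv.segment_subset he' heC, ?_⟩, ?_⟩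
    · intro x hx y hy z hz hzxy
      rw [hseg] at hz ⊢
      obtain ⟨t, ht0, ht1, rfl⟩ := hz
      have hxe : x + (m + 1 - u x) • v = e := by
        refine he.2 (x₂ := y + (m + 1 - u y) • v) ⟨hh x hx, by simp [huv]⟩ ⟨hh y hy, by simp [huv]⟩ ?_
        obtain ⟨a, b, ha, hb, hab, h⟩ := hzxy
        refine ⟨a, b, ha, hb, hab, ?_⟩
        have hux := congrArg u h
        simp only [map_add, map_sub, map_smul, huv, heu, smul_eq_mul, mul_one] at hux
        have h3 : e = a • x + b • y + t • v := by rw [h]; module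
        have h4 : t = a * (m + 1 - u x) + b * (m + 1 - u y) := by
          have : b = 1 - a := by linarith
          subst this
          linarith
        rw [h3, h4]
        module
      refine ⟨m + 1 - u x, by linarith [hu x hx], by linarith [hu' x hx], ?_⟩
      rw [← hxe]; module
    · rw [vectorSpan_segment]
      have : e -ᵥ (e - (2 * (m + 1) : ℝ) • v) = (2 * (m + 1) : ℝ) • v := by
        rw [vsub_eq_sub]; module
      rw [this]
      exact Submodule.span_singleton_smul_eq (IsUnit.mk0 _ (by positivity)) v

/-- the covering statement -/
lemma cover {d : ℕ} (b : Module.Basis (Fin d) ℝ (Fin d → ℝ)) (K : Set (Fin d → ℝ))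
    (hK : IsOpen K) (n : ℕ)
    (hle : ∀ x, ∀ A : Finset (Fin d → ℝ), (∀ a ∈ A, a ∈ Submodule.span ℤ (Set.range b)) →
      (∀ a ∈ A, x + a ∈ K) → A.card ≤ n)
    (hvol : volume K = n * volume (ZSpan.fundamentalDomain b)) :
    Dense {x | ∃ A : Finset (Fin d → ℝ), (∀ a ∈ A, a ∈ Submodule.span ℤ (Set.range b)) ∧
      (∀ a ∈ A, x + a ∈ K) ∧ A.card = n} := by
  classical
  set L := Submodule.span ℤ (Set.range b) with hL
  set F := ZSpan.fundamentalDomain b with hF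
  have hfd : IsAddFundamentalDomain L F volume := ZSpan.isAddFundamentalDomain b volume
  have : Countable L := inferInstance
  have hvinv : VAddInvariantMeasure L (Fin d → ℝ) volume :=
    ⟨fun g s _ => measure_preimage_add volume (g : Fin d → ℝ) s⟩
  set f : (Fin d → ℝ) → ℝ≥0∞ := fun x => ∑' g : L, K.indicator 1 (g +ᵥ x) with hf
  have hsum : ∀ x (s : Finset L), ∑ g ∈ s, K.indicator (1 : (Fin d → ℝ) → ℝ≥0∞) (g +ᵥ x) =
      (((s.filter (fun g : L => x + (g : Fin d → ℝ) ∈ K)).image Subtype.val).card : ℝ≥0∞) := by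
    intro x s
    rw [Finset.card_image_of_injective _ Subtype.val_injective, Finset.card_filter]
    push_cast
    apply Finset.sum_congr rfl
    intro g _
    rw [Set.indicator_apply]
    simp [Submodule.vadd_def, add_comm x]
  have hcard : ∀ x (s : Finset L),
      (((s.filter (fun g : L => x + (g : Fin d → ℝ) ∈ K)).image Subtype.val)).card ≤ n := by
    intro x s
    apply hle x
    · intro a ha
      obtain ⟨g, hg, rfl⟩ := Finset.mem_image.1 ha
      exact g.2
    · intro a ha
      obtain ⟨g, hg, rfl⟩ := Finset.mem_image.1 ha
      exact (Finset.mem_filter.1 hg).2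
  have hfle : ∀ x, f x ≤ n := by
    intro x
    simp only [hf]
    rw [ENNReal.tsum_eq_iSup_sum]
    refine iSup_le fun s => ?_
    rw [hsum]
    exact_mod_cast hcard x s
  have hfeq : ∀ x, f x = n → ∃ A : Finset (Fin d → ℝ), (∀ a ∈ A, a ∈ L) ∧
      (∀ a ∈ A, x + a ∈ K) ∧ A.card = n := by
    intro x hx
    by_contra hcon
    push Not at hcon
    have hlt : ∀ s : Finset L,
      (((s.filter (fun g : L => x + (g : Fin d → ℝ) ∈ K)).image Subtype.val)).card + 1 ≤ n := by
      intro s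
      refine lt_of_le_of_ne (hcard x s) (hcon _ ?_ ?_)
      · intro a ha
        obtain ⟨g, hg, rfl⟩ := Finset.mem_image.1 ha
        exact g.2
      · intro a ha
        obtain ⟨g, hg, rfl⟩ := Finset.mem_image.1 ha
        exact (Finset.mem_filter.1 hg).2
    have hn : 1 ≤ n := le_trans (by omega) (hlt ∅)
    have : f x ≤ ((n - 1 : ℕ) : ℝ≥0∞) := by
      simp only [hf]
      rw [ENNReal.tsum_eq_iSup_sum]
      refine iSup_le fun s => ?_
      rw [hsum]
      have := hlt s
      exact_mod_cast (by omega)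
    rw [hx] at this
    have : n ≤ n - 1 := by exact_mod_cast this
    omega
  have hmeas : ∀ g : L, Measurable (fun x => K.indicator (1 : (Fin d → ℝ) → ℝ≥0∞) (g +ᵥ x)) := by
    intro g
    refine (measurable_one.indicator hK.measurableSet).comp ?_
    exact measurable_const_vadd g
  have hint : ∫⁻ x in F, f x = volume K := by
    simp only [hf]
    rw [lintegral_tsum (fun g => (hmeas g).aemeasurable)]
    rw [← hfd.lintegral_eq_tsum'' (K.indicator 1)]
    rw [lintegral_indicator_one hK.measurableSet]
  have hFfin : volume F ≠ ∞ := (ZSpan.fundamentalDomain_isBounded b).measure_lt_top.ne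
  have hae : f =ᵐ[volume.restrict F] fun _ => (n : ℝ≥0∞) := by
    apply ae_eq_of_ae_le_of_lintegral_le
    · exact Filter.Eventually.of_forall hfle
    · rw [hint, hvol]; exact ENNReal.mul_ne_top (by simp) hFfin
    · exact aemeasurable_const
    · rw [hint, hvol, lintegral_const]; simp
  have hFm : MeasurableSet F := ZSpan.fundamentalDomain_measurableSet b
  have hinv : ∀ (g : L) x, f (g +ᵥ x) = f x := by
    intro g x
    simp only [hf]
    rw [← (Equiv.addRight g).tsum_eq (fun h : L => K.indicator (1 : (Fin d → ℝ) → ℝ≥0∞) (h +ᵥ x))]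
    apply tsum_congr
    intro h
    simp [add_vadd]
  have hnull : volume {x | f x ≠ n} = 0 := by
    apply hfd.measure_zero_of_invariant
    · intro g
      ext x
      rw [Set.mem_vadd_set_iff_neg_vadd_mem]
      simp only [Set.mem_ofPred_eq, hinv]
    · have : volume.restrict F {x | f x ≠ n} = 0 := hae
      rwa [Measure.restrict_apply' hFm] at this
  have hd : Dense {x | f x = n} := Measure.dense_of_ae (μ := volume) (p := fun x => f x = n) hnull
  exact hd.mono fun x hx => hfeq x hx

/-- Equality case in van der Corput's inequality: if `|Λ ∩ int C| > 1` and
`vol C = (|Λ ∩ int C| + 1) · 2^{d-1} · det Λ`, then the linear span `g` of `Λ ∩ int C`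
is a line (a 1-dimensional subspace), `C` is a polytope, and `C` has an edge
(a 1-dimensional face, here an extreme subset whose direction span is 1-dimensional)
parallel to `g`. -/
theorem van_der_corput_equality_case
    (d : ℕ) (M : Matrix (Fin d) (Fin d) ℝ) (hM : M.det ≠ 0)
    (C : Set (Fin d → ℝ)) (hCcompact : IsCompact C) (hCconv : Convex ℝ C)
    (hCint : (interior C).Nonempty) (hCsym : ∀ x ∈ C, -x ∈ C)
    (hcard : 1 < (matLattice M ∩ interior C).ncard)
    (heq : volume C =
      ENNReal.ofReal ((((matLattice M ∩ interior C).ncard : ℝ) + 1) *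
        2 ^ (d - 1) * |M.det|)) :
    Module.finrank ℝ ↥(Submodule.span ℝ (matLattice M ∩ interior C)) = 1 ∧
    (∃ V : Finset (Fin d → ℝ), C = convexHull ℝ (V : Set (Fin d → ℝ))) ∧
    (∃ E : Set (Fin d → ℝ), IsExtreme ℝ C E ∧
      vectorSpan ℝ E = Submodule.span ℝ (matLattice M ∩ interior C)) := by
  classical
  have hKsym : ∀ x ∈ interior C, -x ∈ interior C := by
    intro x hx
    refine interior_maximal (s := C) (t := (fun y => -y) ⁻¹' interior C) (fun y hy => ?_)
      (isOpen_interior.preimage continuous_neg) (by simpa using hx)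
    simpa using hCsym _ (interior_subset hy)
  have hhalf : ∀ x y, x ∈ interior C → y ∈ C → (1/2:ℝ) • x + (1/2:ℝ) • y ∈ interior C :=
    fun x y hx hy => hCconv.combo_interior_self_mem_interior hx hy (by norm_num) (by norm_num)
      (by norm_num)
  have h0 : (0 : Fin d → ℝ) ∈ interior C := by
    obtain ⟨x, hx⟩ := hCint
    have := hhalf x (-x) hx (hCsym _ (interior_subset hx))
    simpa using this
  have hd : 1 ≤ d := by
    by_contra h
    obtain rfl : d = 0 := by omega
    have : (matLattice M ∩ interior C).Subsingleton := fun x _ y _ => Subsingleton.elim _ _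
    have := Set.ncard_le_one_iff_subsingleton.2 this
    omega
  -- the lattice
  have hcolsM : ∀ (N : Matrix (Fin d) (Fin d) ℝ), N.det ≠ 0 →
      ∃ b : Module.Basis (Fin d) ℝ (Fin d → ℝ), (∀ j, b j = N.col j) := by
    intro N hN
    have hli : LinearIndependent ℝ N.col :=
      Matrix.linearIndependent_cols_iff_isUnit.2 ((Matrix.isUnit_iff_isUnit_det N).2 hN.isUnit)
    refine ⟨basisOfLinearIndependentOfCardEqFinrank' N.col hli (by simp), fun j => by simp⟩
  have hspan : ∀ (N : Matrix (Fin d) (Fin d) ℝ) (b : Module.Basis (Fin d) ℝ (Fin d → ℝ)),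
      (∀ j, b j = N.col j) → ∀ x, x ∈ Submodule.span ℤ (Set.range b) ↔ x ∈ matLattice N := by
    intro N b hb x
    rw [Submodule.mem_span_range_iff_exists_fun]
    simp only [matLattice, Set.mem_range]
    apply exists_congr
    intro z
    rw [show (∑ i, z i • b i) = N.mulVec fun i => (z i : ℝ) from ?_]
    ext i
    simp [Matrix.mulVec, dotProduct, hb, Matrix.col, mul_comm]
  obtain ⟨b, hb⟩ := hcolsM M hM
  have hM2 : ((2:ℝ) • M).det = 2 ^ d * M.det := by
    rw [Matrix.det_smul]; simp
  obtain ⟨b2, hb2⟩ := hcolsM ((2:ℝ) • M) (by rw [hM2]; positivity)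
  have hbM := hspan M b hb
  have hb2M : ∀ x, x ∈ Submodule.span ℤ (Set.range b2) ↔
      (1/2:ℝ) • x ∈ Submodule.span ℤ (Set.range b) := by
    intro x
    rw [hspan _ b2 hb2, hbM]
    simp only [matLattice, Set.mem_range]
    apply exists_congr
    intro z
    rw [Matrix.smul_mulVec]
    constructor
    · rintro rfl; rw [smul_smul]; norm_num
    · intro h; rw [h, smul_smul]; norm_num
  set L := (Submodule.span ℤ (Set.range b)).toAddSubgroup with hL
  have hLM : ∀ x, x ∈ L ↔ x ∈ matLattice M := fun x => by
    rw [hL, Submodule.mem_toAddSubgroup]; exact hbM x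
  have hSfin : (matLattice M ∩ interior C).Finite := Set.finite_of_ncard_pos (by omega)
  set S := hSfin.toFinset with hSdef
  have hSmem : ∀ s, s ∈ S ↔ s ∈ L ∧ s ∈ interior C := by
    intro s; rw [hSdef, Set.Finite.mem_toFinset, Set.mem_inter_iff, hLM]
  have hScard : (matLattice M ∩ interior C).ncard = S.card :=
    Set.ncard_eq_toFinset_card _ hSfin
  obtain ⟨m, v, hSm, hA1, hA2⟩ := comb' S ((hSmem 0).2 ⟨L.zero_mem, h0⟩)
    (fun s hs => (hSmem _).2 ⟨L.neg_mem ((hSmem s).1 hs).1, hKsym _ ((hSmem s).1 hs).2⟩)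
  have hm : 1 ≤ m := by omega
  -- volumes
  have hdet2 : (Matrix.of ⇑b2) = ((2:ℝ) • M).transpose := by
    ext i j
    simp [hb2, Matrix.col]
  have hvol : volume (interior C) = ((m + 1 : ℕ) : ℝ≥0∞) * volume (ZSpan.fundamentalDomain b2) := by
    have h1 : volume (interior C) = volume C := by
      have hfr := hCconv.addHaar_frontier volume
      exact measure_congr (interior_ae_eq_of_null_frontier hfr)
    rw [h1, heq, ZSpan.volume_fundamentalDomain, hdet2, Matrix.det_transpose, hM2, hScard, hSm,
      ← ENNReal.ofReal_natCast, ← ENNReal.ofReal_mul (by positivity), abs_mul]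
    congr 1
    obtain ⟨e, rfl⟩ : ∃ e, d = e + 1 := ⟨d - 1, by omega⟩
    rw [abs_of_pos (by positivity : (0:ℝ) < 2 ^ (e+1))]
    push_cast
    ring
  -- transfer of finite sets
  have htrans : ∀ x, ∀ A : Finset (Fin d → ℝ), (∀ a ∈ A, a ∈ Submodule.span ℤ (Set.range b2)) →
      (∀ a ∈ A, x + a ∈ interior C) →
      (∀ p ∈ A.image (fun a => (1/2:ℝ) • a), ∀ q ∈ A.image (fun a => (1/2:ℝ) • a), p - q ∈ S) ∧
      (A.image (fun a => (1/2:ℝ) • a)).card = A.card := by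
    intro x A hAL hAK
    constructor
    · intro p hp q hq
      obtain ⟨a, ha, rfl⟩ := Finset.mem_image.1 hp
      obtain ⟨c, hc, rfl⟩ := Finset.mem_image.1 hq
      refine (hSmem _).2 ⟨L.sub_mem ((hb2M a).1 (hAL a ha)) ((hb2M c).1 (hAL c hc)), ?_⟩
      have := hhalf _ _ (hAK a ha) (hCsym _ (interior_subset (hAK c hc)))
      convert this using 1
      module
    · exact Finset.card_image_of_injective _ (smul_right_injective _ (by norm_num))
  have hdense := cover b2 (interior C) isOpen_interior (m + 1)
    (fun x A h1 h2 => by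
      obtain ⟨h3, h4⟩ := htrans x A h1 h2
      rw [← h4]; exact hA1 _ h3) hvol
  have hgood : ∀ x ∈ {x | ∃ A : Finset (Fin d → ℝ),
      (∀ a ∈ A, a ∈ Submodule.span ℤ (Set.range b2)) ∧
      (∀ a ∈ A, x + a ∈ interior C) ∧ A.card = m + 1},
      (v ≠ 0 ∧ (∀ s, s ∈ S ↔ ∃ k : ℤ, |k| ≤ m ∧ s = k • v)) ∧
      ∃ l ∈ L, x + (2:ℝ) • l ∈ C ∧ x + (2:ℝ) • l + (2 * m : ℝ) • v ∈ C := by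
    rintro x ⟨A, h1, h2, h3⟩
    obtain ⟨h4, h5⟩ := htrans x A h1 h2
    obtain ⟨h6, h7, a, ha, ha'⟩ := hA2 _ h4 (by omega) hm
    refine ⟨⟨h6, h7⟩, a, ?_⟩
    obtain ⟨p, hp, rfl⟩ := Finset.mem_image.1 ha
    obtain ⟨q, hq, hpq⟩ := Finset.mem_image.1 ha'
    refine ⟨(hb2M p).1 (h1 p hp), ?_, ?_⟩
    · convert interior_subset (h2 p hp) using 1
      module
    · convert interior_subset (h2 q hq) using 1
      have : q = (2:ℝ) • ((1/2:ℝ) • q) := by module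
      rw [this, hpq, ← Nat.cast_smul_eq_nsmul ℝ]
      module
  obtain ⟨x0, hx0⟩ := hdense.nonempty
  obtain ⟨⟨hv0, hSv⟩, -⟩ := hgood x0 hx0
  have hLclosed : IsClosed (L : Set (Fin d → ℝ)) := AddSubgroup.isClosed_of_discrete
  have hclosed : IsClosed {x | ∃ l ∈ L, x + (2:ℝ) • l ∈ C ∧ x + (2:ℝ) • l + (2 * m : ℝ) • v ∈ C} := by
    have hX2 : IsClosed ((fun l => (-2:ℝ) • l) '' (L : Set (Fin d → ℝ))) :=
      (Homeomorph.smulOfNeZero (-2:ℝ) (by norm_num)).isClosedMap _ hLclosed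
    have hT : IsCompact (C ∩ (fun y => y + (2 * m : ℝ) • v) ⁻¹' C) :=
      hCcompact.inter_right (hCcompact.isClosed.preimage (by fun_prop))
    convert hX2.add_right_of_isCompact hT using 1
    ext x
    simp only [Set.mem_ofPred_eq, Set.mem_add, Set.mem_image]
    constructor
    · rintro ⟨l, hl, h⟩
      exact ⟨_, ⟨l, hl, rfl⟩, _, h, by module⟩
    · rintro ⟨_, ⟨l, hl, rfl⟩, c, hc, rfl⟩
      refine ⟨l, hl, ?_⟩
      rw [show (-2:ℝ) • l + c + (2:ℝ) • l = c by module]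
      exact hc
  have hstar : ∀ x, ∃ l ∈ L, x + (2:ℝ) • l ∈ C ∧ x + (2:ℝ) • l + (2 * m : ℝ) • v ∈ C := by
    intro x
    exact closure_minimal (fun y hy => (hgood y hy).2) hclosed (hdense x)
  have hspanv : Submodule.span ℝ (matLattice M ∩ interior C) = Submodule.span ℝ {v} := by
    have hSet : ∀ s, s ∈ matLattice M ∩ interior C ↔ s ∈ S := fun s => by
      rw [hSdef, Set.Finite.mem_toFinset]
    apply le_antisymm
    · rw [Submodule.span_le]
      intro s hs
      obtain ⟨k, -, rfl⟩ := (hSv s).1 ((hSet s).1 hs)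
      rw [← Int.cast_smul_eq_zsmul ℝ]
      exact Submodule.smul_mem _ _ (Submodule.mem_span_singleton_self v)
    · rw [Submodule.span_le, Set.singleton_subset_iff]
      exact Submodule.subset_span ((hSet v).2 ((hSv v).2 ⟨1, by simpa using hm, by simp⟩))
  obtain ⟨hpoly, hedge⟩ := geom L C hCcompact hCconv h0 hCsym m hm v hv0
    (fun s => by rw [← hSmem, hSv]) hstar
  rw [hspanv]
  exact ⟨finrank_span_singleton hv0, hpoly, hedge⟩
end
end

section
/- Let d ≥ 1 and let S ⊆ ℝ^d be a d-dimensional lattice simplex whose interior contains exactly one point x of ℤ^d. Let β_0, β_1, …, β_d > 0 be the barycentric coordinates of x with respect to S. Then β_0 · β_1 ⋯ β_d ≥ 1/(s_{d+1} − 1)^2. -/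
open MeasureTheory ENNReal

noncomputable section

open Finset in
lemma abel_aux (x y : ℕ → ℝ) (k : ℕ) (hx : ∀ i ≤ k, 0 < x i) (hs : ∀ i < k, x (i+1) ≤ x i)
    (hp : ∀ l ≤ k, ∑ i ∈ range l, x i ≤ ∑ i ∈ range l, y i) :
    ∑ i ∈ range (k+1), (y i / x i - 1) ≤
      (∑ i ∈ range (k+1), y i - ∑ i ∈ range (k+1), x i) / x k := by
  induction k with
  | zero =>
    have := hx 0 le_rfl
    simp only [zero_add, sum_range_one]
    rw [sub_div, div_self this.ne']
  | succ k ih =>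
    have h1 := ih (fun i hi => hx i (by omega)) (fun i hi => hs i (by omega))
      (fun l hl => hp l (by omega))
    rw [sum_range_succ _ (k+1), sum_range_succ y (k+1), sum_range_succ x (k+1)]
    have h2 := hp (k+1) le_rfl
    have hk := hx (k+1) le_rfl
    have h3 : (∑ i ∈ range (k+1), y i - ∑ i ∈ range (k+1), x i) / x k ≤
        (∑ i ∈ range (k+1), y i - ∑ i ∈ range (k+1), x i) / x (k+1) :=
      div_le_div_of_nonneg_left (by linarith) hk (hs k (by omega))
    have h4 : (∑ i ∈ range (k+1), y i + y (k+1) - (∑ i ∈ range (k+1), x i + x (k+1))) / x (k+1)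
      = (∑ i ∈ range (k+1), y i - ∑ i ∈ range (k+1), x i) / x (k+1) + (y (k+1) / x (k+1) - 1) := by
      field_simp
      ring
    rw [h4]
    linarith

open Finset in
lemma prod_major (x y : ℕ → ℝ) (k : ℕ) (hx : ∀ i ≤ k, 0 < x i) (hs : ∀ i < k, x (i+1) ≤ x i)
    (hy : ∀ i, 0 ≤ y i)
    (hp : ∀ l ≤ k, ∑ i ∈ range l, x i ≤ ∑ i ∈ range l, y i)
    (hk : ∑ i ∈ range (k+1), y i ≤ ∑ i ∈ range (k+1), x i) :
    ∏ i ∈ range (k+1), y i ≤ ∏ i ∈ range (k+1), x i := by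
  have h := abel_aux x y k hx hs hp
  have h0 : ∑ i ∈ range (k+1), (y i / x i - 1) ≤ 0 :=
    h.trans (div_nonpos_of_nonpos_of_nonneg (by linarith) (hx k le_rfl).le)
  have h1 : ∏ i ∈ range (k+1), (y i / x i) ≤ 1 := by
    calc ∏ i ∈ range (k+1), (y i / x i) ≤ ∏ i ∈ range (k+1), Real.exp (y i / x i - 1) := by
          apply prod_le_prod
          · intro i hi
            exact div_nonneg (hy i) (hx i (by simp at hi; omega)).le
          · intro i hi
            have := Real.add_one_le_exp (y i / x i - 1)
            linarith
      _ = Real.exp (∑ i ∈ range (k+1), (y i / x i - 1)) := (Real.exp_sum _ _).symm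
      _ ≤ 1 := Real.exp_le_one_iff.2 h0
  rw [Finset.prod_div_distrib] at h1
  have hP : 0 < ∏ i ∈ range (k+1), x i :=
    prod_pos (fun i hi => hx i (by simp at hi; omega))
  rwa [div_le_one hP] at h1

lemma sylAux_two_le (n : ℕ) : 2 ≤ sylAux n := by
  induction n with
  | zero => simp [sylAux]
  | succ n ih =>
    simp only [sylAux]
    have : 1 ≤ sylAux n - 1 := by omega
    nlinarith

lemma sylAux_succ_real (n : ℕ) :
    (sylAux (n+1) : ℝ) - 1 = sylAux n * ((sylAux n : ℝ) - 1) := by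
  have := sylAux_two_le n
  simp only [sylAux]
  push_cast [Nat.cast_sub (show 1 ≤ sylAux n by omega)]
  ring

open Finset in
lemma syl_facts (n : ℕ) :
    ∏ i ∈ range n, (1 / (sylAux i : ℝ)) = 1 / ((sylAux n : ℝ) - 1) ∧
    ∑ i ∈ range n, (1 / (sylAux i : ℝ)) = 1 - 1 / ((sylAux n : ℝ) - 1) := by
  induction n with
  | zero => simp [sylAux]; norm_num
  | succ n ih =>
    have h2 : (2 : ℝ) ≤ sylAux n := by exact_mod_cast sylAux_two_le n
    have h3 : (sylAux n : ℝ) - 1 ≠ 0 := by linarith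
    rw [prod_range_succ, sum_range_succ, ih.1, ih.2, sylAux_succ_real]
    constructor
    · field_simp
    · field_simp
      ring

open Finset in
lemma ik_bound (n : ℕ) (x : ℕ → ℝ) (hx : ∀ i ≤ n, 0 < x i) (hs : ∀ i < n, x (i+1) ≤ x i)
    (hsum : ∑ i ∈ range (n+1), x i = 1)
    (h : ∀ k ≤ n, ∏ i ∈ range k, x i ≤ 1 - ∑ i ∈ range k, x i) :
    1 / ((sylAux n : ℝ) - 1) ^ 2 ≤ ∏ i ∈ range (n+1), x i := by
  have key : ∀ k ≤ n, ∑ i ∈ range k, x i ≤ ∑ i ∈ range k, (1 / (sylAux i : ℝ)) := by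
    intro k
    induction k using Nat.strong_induction_on with
    | _ k ih =>
      intro hk
      rcases k with _ | k
      · simp
      by_contra! hc
      have h1 := prod_major x (fun i => 1 / (sylAux i : ℝ)) k (fun i hi => hx i (by omega))
        (fun i hi => hs i (by omega)) (fun i => by positivity)
        (fun l hl => ih l (by omega) (by omega)) hc.le
      have h2 := h (k+1) hk
      have h3 := syl_facts (k+1)
      rw [h3.1] at h1
      rw [h3.2] at hc
      linarith
  have h2 : (2 : ℝ) ≤ sylAux n := by exact_mod_cast sylAux_two_le n
  have h3 : (0:ℝ) < (sylAux n : ℝ) - 1 := by linarith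
  set y : ℕ → ℝ := fun i => if i < n then 1 / (sylAux i : ℝ) else 1 / ((sylAux n : ℝ) - 1) with hy
  have hyl : ∀ l ≤ n, ∀ i ∈ range l, y i = 1 / (sylAux i : ℝ) := by
    intro l hl i hi
    simp only [mem_range] at hi
    simp [hy, show i < n by omega]
  have hyn : y n = 1 / ((sylAux n : ℝ) - 1) := by simp [hy]
  have h4 := prod_major x y n hx hs (fun i => by simp only [hy]; split_ifs <;> positivity)
    (fun l hl => by rw [sum_congr rfl (hyl l hl)]; exact key l hl)
    (by rw [hsum, sum_range_succ, sum_congr rfl (hyl n le_rfl), (syl_facts n).2, hyn]; simp)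
  rw [prod_range_succ, prod_congr rfl (hyl n le_rfl), (syl_facts n).1, hyn] at h4
  convert h4 using 1
  field_simp

lemma minkowski_aux {ι : Type} [Fintype ι] [DecidableEq ι] (b : ι → ℝ) (hb : ∀ i, 0 < b i)
    (hσ : 0 < 1 - ∑ i, b i) (hlt : 1 - ∑ i, b i < ∏ i, b i) :
    ∃ n : ι → ℤ, n ≠ 0 ∧ ∀ i, |(∑ j, (n j : ℝ)) * b i - n i| < b i := by
  classical
  set M : Matrix ι ι ℝ := 1 + (Matrix.replicateCol Unit (-b) : Matrix ι Unit ℝ) *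
    (Matrix.replicateRow Unit (fun _ => (1:ℝ)) : Matrix Unit ι ℝ) with hM
  have hdet : M.det = 1 - ∑ i, b i := by
    rw [hM, Matrix.det_one_add_replicateCol_mul_replicateRow]
    simp [dotProduct, sub_eq_add_neg]
  have hMv : ∀ (u : ι → ℝ) i, Matrix.toLin' M u i = u i - (∑ j, u j) * b i := by
    intro u i
    simp [hM, Matrix.toLin'_apply, Matrix.add_mulVec, Matrix.mulVec, dotProduct,
      Matrix.mul_apply, Finset.mul_sum, Finset.sum_mul]
    simp [Matrix.one_apply, add_mul, Finset.sum_add_distrib, mul_comm, sub_eq_add_neg]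
  have hdet' : LinearMap.det (Matrix.toLin' M) = 1 - ∑ i, b i := by
    rw [LinearMap.det_toLin', hdet]
  set s : Set (ι → ℝ) := Matrix.toLin' M ⁻¹' (Set.univ.pi fun i => Set.Ioo (-b i) (b i)) with hs
  have hvol : volume s = ENNReal.ofReal ((1 - ∑ i, b i)⁻¹ * ∏ i, (2 * b i)) := by
    rw [hs, Measure.addHaar_preimage_linearMap _ (by rw [hdet']; exact hσ.ne'), hdet',
      Real.volume_pi_Ioo, abs_of_pos (inv_pos.2 hσ), ENNReal.ofReal_mul (inv_pos.2 hσ).le,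
      ENNReal.ofReal_prod_of_nonneg (fun i _ => by have := hb i; positivity)]
    congr 2
    ext i
    congr 1
    ring
  have fund := ZSpan.isAddFundamentalDomain (Pi.basisFun ℝ ι) volume
  have hF : volume (ZSpan.fundamentalDomain (Pi.basisFun ℝ ι)) = 1 := by
    rw [ZSpan.volume_fundamentalDomain]
    have : (Matrix.of (Pi.basisFun ℝ ι) : Matrix ι ι ℝ) = 1 := by
      ext i j
      simp [Matrix.one_apply, Pi.single_apply, eq_comm]
    rw [this]; simp
  have hcount : Countable (Submodule.span ℤ (Set.range (Pi.basisFun ℝ ι))).toAddSubgroup := by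
    exact inferInstanceAs (Countable (Submodule.span ℤ (Set.range (Pi.basisFun ℝ ι))))
  have hsymm : ∀ u ∈ s, -u ∈ s := by
    intro u hu i hi
    have := hu i hi
    rw [map_neg]
    simp only [Pi.neg_apply]
    constructor <;> linarith [this.1, this.2]
  have hconv : Convex ℝ s :=
    (convex_pi fun i _ => convex_Ioo _ _).linear_preimage _
  have hbig : volume (ZSpan.fundamentalDomain (Pi.basisFun ℝ ι)) *
      2 ^ Module.finrank ℝ (ι → ℝ) < volume s := by
    rw [hF, hvol, one_mul, Module.finrank_fintype_fun_eq_card, Finset.prod_mul_distrib,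
      Finset.prod_const, Finset.card_univ]
    have : (2 : ℝ≥0∞) ^ Fintype.card ι = ENNReal.ofReal (2 ^ Fintype.card ι) := by
      rw [ENNReal.ofReal_pow (by norm_num)]; simp
    rw [this]
    apply (ENNReal.ofReal_lt_ofReal_iff (by
      have := Finset.prod_pos (fun i (_ : i ∈ Finset.univ) => hb i)
      positivity)).2
    rw [inv_mul_eq_div, lt_div_iff₀ hσ]
    have h2 : (0:ℝ) < 2 ^ Fintype.card ι := by positivity
    nlinarith
  obtain ⟨z, hz0, hzs⟩ := exists_ne_zero_mem_lattice_of_measure_mul_two_pow_lt_measure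
    (L := (Submodule.span ℤ (Set.range (Pi.basisFun ℝ ι))).toAddSubgroup) (s := s) fund
    hsymm hconv hbig
  · have hmem : (z : ι → ℝ) ∈ Submodule.span ℤ (Set.range (Pi.basisFun ℝ ι)) := z.2
    rw [Module.Basis.mem_span_iff_repr_mem] at hmem
    choose n hn using hmem
    have hn' : ∀ i, (n i : ℝ) = (z : ι → ℝ) i := by
      intro i; simpa using hn i
    refine ⟨n, ?_, ?_⟩
    · rintro rfl
      apply hz0
      ext i
      simpa using (hn' i).symm
    · intro i
      have := hzs i (Set.mem_univ i)
      rw [hMv] at this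
      simp only [← hn'] at this
      rw [abs_lt]
      constructor <;> linarith [this.1, this.2]

lemma minkowski_pos {ι : Type} [Fintype ι] [DecidableEq ι] (b : ι → ℝ) (hb : ∀ i, 0 < b i)
    (hσ : 0 < 1 - ∑ i, b i) (hlt : 1 - ∑ i, b i < ∏ i, b i) :
    ∃ n : ι → ℤ, 0 < ∑ j, n j ∧ ∀ i, (n i : ℝ) < (∑ j, (n j : ℝ)) * b i + b i := by
  obtain ⟨n, hn0, hn⟩ := minkowski_aux b hb hσ hlt
  rcases lt_trichotomy (∑ j, n j) 0 with h | h | h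
  · refine ⟨-n, by simpa using h, fun i => ?_⟩
    have := abs_lt.1 (hn i)
    simp
    linarith [this.1, this.2]
  · exfalso
    apply hn0
    ext i
    have h1 := hn i
    have h2 : (∑ j, (n j : ℝ)) = 0 := by exact_mod_cast h
    have h3 : b i ≤ ∑ j, b j :=
      Finset.single_le_sum (fun j _ => (hb j).le) (Finset.mem_univ i)
    rw [h2, zero_mul, zero_sub, abs_neg] at h1
    have h4 : |(n i : ℝ)| < 1 := by linarith
    have h5 : |n i| < 1 := by exact_mod_cast h4
    simpa using Int.abs_lt_one_iff.1 h5
  · refine ⟨n, h, fun i => ?_⟩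
    have := abs_lt.1 (hn i)
    linarith [this.1, this.2]

lemma latticePts_eq_of_interior
    (d : ℕ) (v : Fin (d + 1) → (Fin d → ℝ)) (hv : AffineIndependent ℝ v)
    (hvlat : ∀ i, v i ∈ latticePts d)
    (x : Fin d → ℝ) (hx : latticePts d ∩ interior (convexHull ℝ (Set.range v)) = {x})
    (β : Fin (d + 1) → ℝ) (hβsum : ∑ i, β i = 1) (hβx : x = ∑ i, β i • v i)
    (N : Fin (d+1) → ℤ) (hN : ∀ i, (N i : ℝ) < (∑ j, (N j : ℝ)) * β i + β i) (i : Fin (d+1)) :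
    (∑ j, (N j : ℝ)) * β i = N i := by
  have htop : affineSpan ℝ (Set.range v) = ⊤ := by
    rw [hv.affineSpan_eq_top_iff_card_eq_finrank_add_one]; simp
  let B : AffineBasis (Fin (d+1)) ℝ (Fin d → ℝ) := ⟨v, hv, htop⟩
  set w : Fin (d+1) → ℝ := fun i => (∑ j, (N j : ℝ)) * β i + β i - N i with hw
  have hw1 : ∑ i, w i = 1 := by
    simp only [hw, Finset.sum_sub_distrib, Finset.sum_add_distrib, ← Finset.mul_sum, hβsum]
    ring
  have hcoord : ∀ u : Fin (d+1) → ℝ, ∑ i, u i = 1 → ∀ i, B.coord i (∑ j, u j • v j) = u i := by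
    intro u hu i
    have := B.coord_apply_combination_of_mem (Finset.mem_univ i) hu
    rwa [Finset.affineCombination_eq_linear_combination _ _ _ hu] at this
  have hmem : (∑ i, w i • v i) ∈ latticePts d ∩ interior (convexHull ℝ (Set.range v)) := by
    constructor
    · have hxl : x ∈ latticePts d := by
        have : x ∈ latticePts d ∩ interior (convexHull ℝ (Set.range v)) := by rw [hx]; rfl
        exact this.1
      obtain ⟨X, hX⟩ := hxl
      choose V hV using hvlat
      refine ⟨fun k => (∑ j, N j) * X k + X k - ∑ i, N i * V i k, ?_⟩
      ext k
      have hXk : (X k : ℝ) = ∑ i, β i * v i k := by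
        have := congrFun (hX.trans hβx) k
        simpa [Finset.sum_apply] using this
      have hVk : ∀ i, (V i k : ℝ) = v i k := fun i => congrFun (hV i) k
      push_cast
      simp only [hVk, hXk, Finset.sum_apply, Pi.smul_apply, smul_eq_mul, hw, sub_mul, add_mul,
        Finset.sum_sub_distrib, Finset.sum_add_distrib, mul_assoc, ← Finset.mul_sum]
    · have := B.interior_convexHull
      change interior (convexHull ℝ (Set.range v)) = _ at this
      rw [this]
      intro i
      rw [hcoord w hw1]
      simp only [hw]
      linarith [hN i]
  rw [hx, Set.mem_singleton_iff, hβx] at hmem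
  have h1 := hcoord w hw1 i
  rw [hmem, hcoord β hβsum] at h1
  simp only [hw] at h1
  linarith

lemma product_sum_ineq
    (d : ℕ) (v : Fin (d + 1) → (Fin d → ℝ)) (hv : AffineIndependent ℝ v)
    (hvlat : ∀ i, v i ∈ latticePts d)
    (x : Fin d → ℝ) (hx : latticePts d ∩ interior (convexHull ℝ (Set.range v)) = {x})
    (β : Fin (d + 1) → ℝ) (hβpos : ∀ i, 0 < β i)
    (hβsum : ∑ i, β i = 1) (hβx : x = ∑ i, β i • v i)
    (I : Finset (Fin (d+1))) (i₀ : Fin (d+1)) (hi₀ : i₀ ∉ I) :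
    ∏ i ∈ I, β i ≤ 1 - ∑ i ∈ I, β i := by
  by_contra! hc
  have hlt : 0 < 1 - ∑ i ∈ I, β i := by
    rw [← hβsum, sub_pos]
    exact Finset.sum_lt_sum_of_subset (Finset.subset_univ I) (Finset.mem_univ i₀) hi₀
      (hβpos i₀) (fun j _ _ => (hβpos j).le)
  rw [← Finset.sum_coe_sort I β] at hlt hc
  rw [← Finset.prod_coe_sort I β] at hc
  obtain ⟨n, hn, hlt⟩ := minkowski_pos (fun i : I => β i) (fun i => hβpos i) hlt hc
  set N : Fin (d+1) → ℤ := fun i => if h : i ∈ I then n ⟨i, h⟩ else 0 with hNdef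
  have hsumN : ∑ j, N j = ∑ j, n j := by
    rw [← Finset.sum_subset (Finset.subset_univ I) (fun j _ hj => by simp [hNdef, hj]),
      ← Finset.sum_coe_sort I N]
    apply Finset.sum_congr rfl
    intro j _
    simp [hNdef]
  have hsumN' : ∑ j, (N j : ℝ) = ∑ j, (n j : ℝ) := by exact_mod_cast hsumN
  have hnR : (0 : ℝ) < ∑ j, (n j : ℝ) := by exact_mod_cast hn
  have := latticePts_eq_of_interior d v hv hvlat x hx β hβsum hβx N (fun i => by
    rw [hsumN']
    by_cases h : i ∈ I
    · have := hlt ⟨i, h⟩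
      simpa [hNdef, h] using this
    · have := hβpos i
      simp only [hNdef, h, dite_false, Int.cast_zero]
      positivity) i₀
  rw [hsumN'] at this
  simp only [hNdef, hi₀, dite_false, Int.cast_zero] at this
  have h5 := mul_pos hnR (hβpos i₀)
  linarith

/-- Theorem 5 (optimality part): for a `d`-dimensional lattice simplex `S` with a unique
interior lattice point `x`, the product of the barycentric coordinates of `x` with respect
to `S` is at least `1/(s_{d+1} - 1)^2`. -/
theorem product_barycentric_coords_lower_bound
    (d : ℕ) (hd : 1 ≤ d)
    (v : Fin (d + 1) → (Fin d → ℝ)) (hv : AffineIndependent ℝ v)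
    (hvlat : ∀ i, v i ∈ latticePts d)
    (S : Set (Fin d → ℝ)) (hS : S = convexHull ℝ (Set.range v))
    (x : Fin d → ℝ) (hx : latticePts d ∩ interior S = {x})
    (β : Fin (d + 1) → ℝ)
    (hβpos : ∀ i, 0 < β i)
    (hβsum : ∑ i, β i = 1)
    (hβx : x = ∑ i, β i • v i) :
    1 / ((syl (d + 1) : ℝ) - 1) ^ 2 ≤ ∏ i, β i := by
  subst hS
  obtain ⟨τ, hτ⟩ : ∃ τ : Equiv.Perm (Fin (d+1)), Antitone (β ∘ τ) :=
    ⟨Tuple.sort (fun i => - β i), fun i j hij => by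
      have := Tuple.monotone_sort (fun i => - β i) hij
      simpa using this⟩
  set a : ℕ → ℝ := fun i => if h : i < d + 1 then β (τ ⟨i, h⟩) else 0 with ha
  have hai : ∀ i : Fin (d+1), a i = β (τ i) := fun i => by simp only [ha, i.2, dite_true]
  have hprod : ∏ i ∈ Finset.range (d+1), a i = ∏ i, β i := by
    rw [← Fin.prod_univ_eq_prod_range, ← Equiv.prod_comp τ β]
    exact Finset.prod_congr rfl (fun i _ => hai i)
  have hsum : ∑ i ∈ Finset.range (d+1), a i = 1 := by
    rw [← Fin.sum_univ_eq_sum_range, ← hβsum, ← Equiv.sum_comp τ β]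
    exact Finset.sum_congr rfl (fun i _ => hai i)
  have := ik_bound d a (fun i hi => by
      have h := hai ⟨i, by omega⟩
      simp only at h
      rw [h]; exact hβpos _) (fun i hi => by
      have h := hai ⟨i, by omega⟩
      have h' := hai ⟨i+1, by omega⟩
      simp only at h h'
      rw [h, h']
      exact hτ (by simp [Fin.le_def])) hsum (fun k hk => by
      have hinj : Function.Injective (fun i : Fin k => τ (Fin.castLE (by omega) i)) := by
        intro i j hij
        simpa using hij
      have h := product_sum_ineq d v hv hvlat x hx β hβpos hβsum hβx
        (Finset.univ.map ⟨_, hinj⟩) (τ ⟨k, by omega⟩) (by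
          simp [Fin.ext_iff]
          intro i
          exact i.2.ne)
      rw [Finset.prod_map, Finset.sum_map] at h
      rw [← Fin.prod_univ_eq_prod_range, ← Fin.sum_univ_eq_sum_range]
      convert h using 2
      · rename_i i _
        exact hai (Fin.castLE (by omega) i)
      · apply Finset.sum_congr rfl
        intro i _
        exact hai (Fin.castLE (by omega) i))
  rw [hprod] at this
  simpa [syl] using this
end
end

section
/- Let d ≥ 1 and k ≥ 0 be integers, let Λ be a lattice of rank d in ℝ^d containing the standard basis vectors e_1, …, e_d, let Δ_0 := conv(0, e_1, …, e_d) and Δ := conv(e_1, …, e_d). Assume that Λ ∩ relint(Δ) = {b} for a single point b = (β_1, …, β_d), and that |Λ ∩ int(Δ_0)| = k. Then the set Y := {y = (y_1,…,y_d) ∈ Λ : |y_i| < β_i for all i = 1,…,d} has cardinality |Y| ≤ 2k + 1. -/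
open MeasureTheory ENNReal

noncomputable section

theorem aux_hull (d : ℕ) :
    convexHull ℝ (Set.range (stdBasis d)) = stdSimplex ℝ (Fin d) := by
  rw [← convexHull_basis_eq_stdSimplex]
  congr 2
  ext i j
  simp [stdBasis, Pi.single_apply, eq_comm]

theorem aux_span (d : ℕ) (x : Fin d → ℝ)
    (hx : x ∈ affineSpan ℝ (convexHull ℝ (Set.range (stdBasis d)))) : ∑ i, x i = 1 := by
  rw [aux_hull] at hx
  refine affineSpan_induction (p := fun x : Fin d → ℝ => ∑ i, x i = 1) hx (fun y hy => hy.2) ?_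
  intro c u v w hu hv hw
  simp [Finset.sum_add_distrib, ← Finset.mul_sum, hu, hv, hw]

theorem aux_relint (d : ℕ) (x : Fin d → ℝ) (h0 : ∀ i, 0 < x i) (h1 : ∑ i, x i = 1) :
    x ∈ intrinsicInterior ℝ (convexHull ℝ (Set.range (stdBasis d))) := by
  have hmem : x ∈ convexHull ℝ (Set.range (stdBasis d)) := by
    rw [aux_hull]; exact ⟨fun i => (h0 i).le, h1⟩
  rw [mem_intrinsicInterior]
  refine ⟨⟨x, subset_affineSpan ℝ _ hmem⟩, ?_, rfl⟩
  rw [mem_interior]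
  refine ⟨{q | ∀ i, 0 < (q : Fin d → ℝ) i}, ?_, ?_, h0⟩
  · intro q hq
    have := aux_span d q q.2
    show (q : Fin d → ℝ) ∈ convexHull ℝ (Set.range (stdBasis d))
    exact (aux_hull d).symm.subset ⟨fun i => (hq i).le, this⟩
  · simp only [Set.setOf_forall]
    exact isOpen_iInter_of_finite fun i =>
      isOpen_lt continuous_const ((continuous_apply i).comp continuous_subtype_val)

theorem aux_int (d : ℕ) (hd : 1 ≤ d) (x : Fin d → ℝ) (h0 : ∀ i, 0 < x i) (h1 : ∑ i, x i < 1) :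
    x ∈ interior (convexHull ℝ (insert 0 (Set.range (stdBasis d)))) := by
  rw [mem_interior]
  refine ⟨{q | (∀ i, 0 < q i) ∧ ∑ i, q i < 1}, ?_, ?_, h0, h1⟩
  · rintro q ⟨hq, hs⟩
    have hpos : 0 < ∑ i, q i :=
      Finset.sum_pos (fun i _ => hq i) ⟨⟨0, hd⟩, Finset.mem_univ _⟩
    have hm : (∑ i, q i)⁻¹ • q ∈ convexHull ℝ (insert 0 (Set.range (stdBasis d))) := by
      apply convexHull_mono (Set.subset_insert _ _)
      rw [aux_hull]
      refine ⟨fun i => mul_nonneg (inv_pos.2 hpos).le (hq i).le, ?_⟩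
      simp only [Pi.smul_apply, smul_eq_mul, ← Finset.mul_sum]
      exact inv_mul_cancel₀ hpos.ne'
    have hz : (0 : Fin d → ℝ) ∈ convexHull ℝ (insert 0 (Set.range (stdBasis d))) :=
      subset_convexHull ℝ _ (Set.mem_insert _ _)
    have := (convex_convexHull ℝ (insert 0 (Set.range (stdBasis d)))).smul_mem_of_zero_mem hz hm
      ⟨hpos.le, hs.le⟩
    rwa [smul_smul, mul_inv_cancel₀ hpos.ne', one_smul] at this
  · rw [Set.setOf_and]
    refine IsOpen.inter ?_ (isOpen_lt (by fun_prop) continuous_const)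
    simp only [Set.setOf_forall]
    exact isOpen_iInter_of_finite fun i => isOpen_lt continuous_const (continuous_apply i)

theorem aux_finite (d : ℕ) (M : Matrix (Fin d) (Fin d) ℝ) (hM : M.det ≠ 0)
    (S : Set (Fin d → ℝ)) (hS : IsCompact S) : (matLattice M ∩ S).Finite := by
  have hK : IsCompact ((fun v => M⁻¹.mulVec v) '' S) :=
    hS.image (Continuous.matrix_mulVec continuous_const continuous_id)
  obtain ⟨R, hR⟩ := hK.isBounded.exists_norm_le
  have hfin : (Set.Icc (fun _ => -⌈R⌉ : Fin d → ℤ) (fun _ => ⌈R⌉)).Finite := Set.finite_Icc _ _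
  refine (hfin.image fun z : Fin d → ℤ => M.mulVec fun i => (z i : ℝ)).subset ?_
  rintro _ ⟨⟨z, rfl⟩, hz⟩
  refine ⟨z, ?_, rfl⟩
  have h := hR _ ⟨_, hz, rfl⟩
  simp only [Matrix.mulVec_mulVec, Matrix.nonsing_inv_mul M (isUnit_iff_ne_zero.2 hM),
    Matrix.one_mulVec] at h
  have h2 : ∀ i, |(z i : ℝ)| ≤ ⌈R⌉ := fun i =>
    ((norm_le_pi_norm (fun i => (z i : ℝ)) i).trans h).trans (Int.le_ceil R)
  constructor <;> intro i <;> have := abs_le.1 (h2 i)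
  · exact_mod_cast this.1
  · exact_mod_cast this.2

theorem aux_add {d : ℕ} (M : Matrix (Fin d) (Fin d) ℝ) {x y : Fin d → ℝ}
    (hx : x ∈ matLattice M) (hy : y ∈ matLattice M) : x + y ∈ matLattice M := by
  obtain ⟨u, rfl⟩ := hx
  obtain ⟨v, rfl⟩ := hy
  refine ⟨u + v, ?_⟩
  simp only [← Matrix.mulVec_add]
  congr 1; ext i; simp

theorem aux_sub {d : ℕ} (M : Matrix (Fin d) (Fin d) ℝ) {x y : Fin d → ℝ}
    (hx : x ∈ matLattice M) (hy : y ∈ matLattice M) : x - y ∈ matLattice M := by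
  obtain ⟨u, rfl⟩ := hx
  obtain ⟨v, rfl⟩ := hy
  refine ⟨u - v, ?_⟩
  simp only [← Matrix.mulVec_sub]
  congr 1; ext i; simp

/-- Counting lemma from the proof of Theorem 2: let `Λ` be a lattice of rank `d`
containing `e_1, …, e_d`, let `Δ_0 = conv(0, e_1, …, e_d)` and `Δ = conv(e_1, …, e_d)`.
If `Λ ∩ relint Δ = {b}` with `b = (β_1, …, β_d)` and `|Λ ∩ int Δ_0| = k`, then the set
`Y = {y ∈ Λ : |y_i| < β_i for all i}` satisfies `|Y| ≤ 2k + 1`. -/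
theorem card_Y_le_two_k_add_one
    (d k : ℕ) (hd : 1 ≤ d)
    (M : Matrix (Fin d) (Fin d) ℝ) (hM : M.det ≠ 0)
    (hbasis : ∀ i : Fin d, stdBasis d i ∈ matLattice M)
    (b : Fin d → ℝ)
    (hb : matLattice M ∩
        intrinsicInterior ℝ (convexHull ℝ (Set.range (stdBasis d))) = {b})
    (hk : (matLattice M ∩
        interior (convexHull ℝ (insert 0 (Set.range (stdBasis d))))).ncard = k) :
    {y ∈ matLattice M | ∀ i, |y i| < b i}.ncard ≤ 2 * k + 1 := by
  have hbm : b ∈ matLattice M ∩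
      intrinsicInterior ℝ (convexHull ℝ (Set.range (stdBasis d))) := by rw [hb]; rfl
  have hbs : ∑ i, b i = 1 :=
    aux_span d b (subset_affineSpan ℝ _ (intrinsicInterior_subset hbm.2))
  set I := matLattice M ∩ interior (convexHull ℝ (insert 0 (Set.range (stdBasis d)))) with hI
  have hIfin : I.Finite := by
    refine (aux_finite d M hM _ (Set.Finite.isCompact_convexHull (𝕜 := ℝ) (s := insert 0 (Set.range (stdBasis d))) ?_)).subset
      (Set.inter_subset_inter_right _ interior_subset)
    exact (Set.finite_range _).insert _
  have hsub : {y ∈ matLattice M | ∀ i, |y i| < b i} ⊆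
      insert 0 ((fun x => x - b) '' I ∪ (fun x => b - x) '' I) := by
    rintro y ⟨hy, hyb⟩
    rcases lt_trichotomy (∑ i, y i) 0 with h | h | h
    · refine Or.inr (Or.inl ⟨b + y, ⟨aux_add M hbm.1 hy, aux_int d hd _ (fun i => ?_) ?_⟩, ?_⟩)
      · have := (abs_lt.1 (hyb i)).1
        simp only [Pi.add_apply]; linarith
      · simp only [Pi.add_apply, Finset.sum_add_distrib]; linarith
      · simp
    · left
      have : b + y ∈ ({b} : Set (Fin d → ℝ)) := by
        rw [← hb]
        refine ⟨aux_add M hbm.1 hy, aux_relint d _ (fun i => ?_) ?_⟩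
        · have := (abs_lt.1 (hyb i)).1
          simp only [Pi.add_apply]; linarith
        · simp only [Pi.add_apply, Finset.sum_add_distrib]; linarith
      simpa using this
    · refine Or.inr (Or.inr ⟨b - y, ⟨aux_sub M hbm.1 hy, aux_int d hd _ (fun i => ?_) ?_⟩, ?_⟩)
      · have := (abs_lt.1 (hyb i)).2
        simp only [Pi.sub_apply]; linarith
      · simp only [Pi.sub_apply, Finset.sum_sub_distrib]; linarith
      · simp
  have h1 := Set.ncard_le_ncard hsub (((hIfin.image _).union (hIfin.image _)).insert _)
  have h2 := Set.ncard_insert_le (0 : Fin d → ℝ) ((fun x => x - b) '' I ∪ (fun x => b - x) '' I)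
  have h3 := Set.ncard_union_le ((fun x => x - b) '' I) ((fun x => b - x) '' I)
  have h4 := Set.ncard_image_le (f := fun x => x - b) hIfin
  have h5 := Set.ncard_image_le (f := fun x => b - x) hIfin
  omega
end
end
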